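/- arXiv:1407.1480 — 5 statements merged into one kernel-verified Lean document; each statement's English description precedes it below -/
import Mathlib

section
/- Every induced path in the graph J_I' − C (the graph obtained from J_I' by removing all c-type vertices) that has an endvertex of a-type or of x-type contains at most 5 vertices. -/
open SimpleGraph

/-- An instance of Not-All-Equal 3-Satisfiability with positive literals:
variables are indexed by `Fin n`, and each of the `m` clauses is an ordered
triple of variables. -/
structure NAE (n m : ℕ) where
  clause : Fin m → Fin 3 → Fin n

/-- A truth assignment in which each clause contains at least one true and at
least one false variable. -/
def NAE.Satisfiable {n m : ℕ} (I : NAE n m) : Prop :=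
  ∃ τ : Fin n → Bool, ∀ j : Fin m,
    (∃ h : Fin 3, τ (I.clause j h) = true) ∧ (∃ h : Fin 3, τ (I.clause j h) = false)

/-- Vertices of the graph `J_I`: `a`- and `b`-type vertices of the two clause
components (`p = false` for the unprimed component, `p = true` for the primed
one), and one `x`-type vertex per variable.  The `a`-vertices of a component are
`a j p 0, a j p 1, a j p 2` and its `b`-vertices `b j p 0, b j p 1`; the
component is the induced path `a j p 0 - b j p 0 - a j p 1 - b j p 1 - a j p 2`. -/
inductive JV (n m : ℕ) where
  | a (j : Fin m) (p : Bool) (h : Fin 3)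
  | b (j : Fin m) (p : Bool) (h : Fin 2)
  | x (i : Fin n)

/-- Base relation for the edges of `J_I`. -/
def JRel {n m : ℕ} (I : NAE n m) : JV n m → JV n m → Prop
  | .a j p h, .b j' p' h' => j = j' ∧ p = p' ∧ (h = h'.castSucc ∨ h = h'.succ)
  | .a j _ h, .x i => I.clause j h = i
  | .x _, .b _ _ _ => True
  | _, _ => False

/-- The graph `J_I`. -/
def JGraph {n m : ℕ} (I : NAE n m) : SimpleGraph (JV n m) := fromRel (JRel I)

/-- The 4-list assignment `L` of `J_I`. -/
def Lassign {n m : ℕ} : JV n m → Finset ℕ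
  | .a _ p h =>
      if p then (if h.val = 0 then {1,4} else if h.val = 1 then {1,3,4} else {1,3})
      else (if h.val = 0 then {2,4} else if h.val = 1 then {2,3,4} else {2,3})
  | .b _ _ _ => {3,4}
  | .x _ => {1,2}

/-- Vertices of the graph `J_I'`: those of `J_I` together with the `c`-type
subdivision vertices, one for each edge between an `a`-type and an `x`-type
vertex (i.e., one for each `a`-type vertex `a j p h`, subdividing its edge to
the vertex of the variable `clause j h`). -/
inductive JV' (n m : ℕ) where
  | a (j : Fin m) (p : Bool) (h : Fin 3)
  | b (j : Fin m) (p : Bool) (h : Fin 2)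
  | x (i : Fin n)
  | c (j : Fin m) (p : Bool) (h : Fin 3)

/-- Base relation for the edges of `J_I'`. -/
def J'Rel {n m : ℕ} (I : NAE n m) : JV' n m → JV' n m → Prop
  | .a j p h, .b j' p' h' => j = j' ∧ p = p' ∧ (h = h'.castSucc ∨ h = h'.succ)
  | .c j p h, .a j' p' h' => j = j' ∧ p = p' ∧ h = h'
  | .c j _ h, .x i => I.clause j h = i
  | .x _, .b _ _ _ => True
  | _, _ => False

/-- The graph `J_I'`. -/
def J'Graph {n m : ℕ} (I : NAE n m) : SimpleGraph (JV' n m) := fromRel (J'Rel I)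

/-- The 4-list assignment `L'` of `J_I'`. -/
def L'assign {n m : ℕ} : JV' n m → Finset ℕ
  | .a _ p h =>
      if p then (if h.val = 0 then {1,4} else if h.val = 1 then {1,3,4} else {1,3})
      else (if h.val = 0 then {2,4} else if h.val = 1 then {2,3,4} else {2,3})
  | .b _ _ _ => {3,4}
  | .x _ => {1,2}
  | .c _ _ _ => {1,2}

/-- `a`-type or `x`-type vertices of `J_I'`. -/
def JV'.isAX {n m : ℕ} : JV' n m → Bool
  | .a _ _ _ => true
  | .x _ => true
  | _ => false

/-- `b`-type vertices of `J_I'`. -/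
def JV'.isB {n m : ℕ} : JV' n m → Bool
  | .b _ _ _ => true
  | _ => false

/-- `c`-type vertices of `J_I'`. -/
def JV'.isC {n m : ℕ} : JV' n m → Bool
  | .c _ _ _ => true
  | _ => false

/-- Vertices of the graph `J_I^k`: the vertices of `J_I'` together with, for
each vertex `v` of `J_I'`, exactly `k - |L'(v)|` pendant vertices. -/
inductive JVK (n m k : ℕ) where
  | orig (v : JV' n m)
  | pend (v : JV' n m) (i : Fin (k - (L'assign v).card))

/-- Base relation for the edges of `J_I^k`. -/
def JKRel {n m k : ℕ} (I : NAE n m) : JVK n m k → JVK n m k → Prop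
  | .orig u, .orig v => J'Rel I u v
  | .pend v _, .orig u => u = v
  | _, _ => False

/-- The graph `J_I^k`. -/
def JKGraph {n m : ℕ} (I : NAE n m) (k : ℕ) : SimpleGraph (JVK n m k) :=
  fromRel (JKRel I)

/-- A graph is chordal bipartite if it is bipartite (2-colourable) and has no
induced cycle on any number of vertices other than four. -/
def ChordalBipartite {V : Type*} (G : SimpleGraph V) : Prop :=
  G.Colorable 2 ∧ ∀ s : ℕ, 3 ≤ s → s ≠ 4 → IsEmpty (cycleGraph s ↪g G)

/-- The disjoint union `P_1 + 2P_2` on five vertices: vertex `0` is isolated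
and `1-2`, `3-4` are the two `P_2`s. -/
def P1plus2P2 : SimpleGraph (Fin 5) :=
  fromRel (fun u v => (u = 1 ∧ v = 2) ∨ (u = 3 ∧ v = 4))

/-- The disjoint union `P_1 + P_4` on five vertices: vertex `0` is isolated and
`1-2-3-4` is the `P_4`. -/
def P1plusP4 : SimpleGraph (Fin 5) :=
  fromRel (fun u v => (u = 1 ∧ v = 2) ∨ (u = 2 ∧ v = 3) ∨ (u = 3 ∧ v = 4))

/-- The vertex of `Fin 23` carrying label `i ∈ {1, …, 23}`. -/
def vtx (i : ℕ) : Fin 23 := ⟨(i - 1) % 23, by omega⟩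

/-- The edges (by labels in `{1, …, 23}`) of the graph `M'`, i.e. of the
Mycielski graph `M_5` minus the edge `{17, 23}`. -/
def MpEdges : List (ℕ × ℕ) :=
  [(1,2),(2,3),(3,5),(5,4),(4,1),
   (6,2),(6,4),(7,1),(7,3),(8,2),(8,5),(9,1),(9,5),(10,3),(10,4),
   (11,6),(11,7),(11,8),(11,9),(11,10),
   (12,2),(12,4),(12,7),(12,9),(13,1),(13,3),(13,6),(13,8),
   (14,2),(14,5),(14,7),(14,10),(15,1),(15,5),(15,6),(15,10),
   (16,3),(16,4),(16,8),(16,9),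
   (17,2),(17,4),(17,11),(18,1),(18,3),(18,11),(19,2),(19,5),(19,11),
   (20,1),(20,5),(20,11),(21,3),(21,4),(21,11),
   (22,6),(22,7),(22,8),(22,9),(22,10),
   (12,23),(13,23),(14,23),(15,23),(16,23),(18,23),(19,23),(20,23),(21,23),(22,23)]

/-- The edges (by labels) of the Mycielski graph `M_5`. -/
def M5Edges : List (ℕ × ℕ) := (17,23) :: MpEdges

/-- The Mycielski graph `M_5` on 23 vertices. -/
def M5 : SimpleGraph (Fin 23) :=
  fromRel (fun u v => ∃ e ∈ M5Edges, u = vtx e.1 ∧ v = vtx e.2)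

/-- The graph `M'`, i.e. `M_5` minus the edge `{17, 23}`. -/
def Mp : SimpleGraph (Fin 23) :=
  fromRel (fun u v => ∃ e ∈ MpEdges, u = vtx e.1 ∧ v = vtx e.2)

/-- The vertex set `T = {2, 4, 11, 23}` of `M'`. -/
def Tset : Set (Fin 23) := {vtx 2, vtx 4, vtx 11, vtx 23}

/-- The list of colours `{1,2,3,4} \ L'(v)`, used to precolour the pendant
vertices attached to `v` in `J_I^4`. -/
def complList {n m : ℕ} : JV' n m → List ℕ
  | .a _ p h =>
      if p then (if h.val = 0 then [2,3] else if h.val = 1 then [2] else [2,4])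
      else (if h.val = 0 then [1,3] else if h.val = 1 then [1] else [1,4])
  | .b _ _ _ => [1,2]
  | .x _ => [3,4]
  | .c _ _ _ => [3,4]

/-- The precolouring `c_{W^4}` of the pendant vertices of `J_I^4`: the pendant
vertices attached to `v` receive the distinct colours of `{1,2,3,4} \ L'(v)`. -/
def cW4 {n m : ℕ} (v : JV' n m) (i : Fin (4 - (L'assign v).card)) : ℕ :=
  (complList v).getD i.val 0

/-- The vertex `t_j` of (the copy of) `M'`, for `j ∈ {1,2,3,4}`:
`t_1 = 2`, `t_2 = 4`, `t_3 = 11`, `t_4 = 23`. -/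
def tvert (j : ℕ) : Fin 23 :=
  if j = 1 then vtx 2 else if j = 2 then vtx 4 else if j = 3 then vtx 11 else vtx 23

/-- Vertices of the graph `J*_I`: the vertices of `J_I'`, the pendant vertices
of `J_I^4` attached to `a`- or `x`-type vertices (the vertices pendant to
`B ∪ C` having been removed), and a copy of `M'`. -/
inductive JStarV (n m : ℕ) where
  | orig (v : JV' n m)
  | pend (v : JV' n m) (i : Fin (4 - (L'assign v).card)) (hv : v.isAX = true)
  | mv (t : Fin 23)

/-- Base relation for the edges of `J*_I`. -/
def JStarRel {n m : ℕ} (I : NAE n m) : JStarV n m → JStarV n m → Prop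
  | .orig u, .orig v => J'Rel I u v
  | .pend v _ _, .orig u => u = v
  | .pend v i _, .mv t => ∃ j ∈ ({1,2,3,4} : Finset ℕ), j ≠ cW4 v i ∧ t = tvert j
  | .orig u, .mv t =>
      (u.isB = true ∧ (t = vtx 2 ∨ t = vtx 4)) ∨
      (u.isC = true ∧ (t = vtx 11 ∨ t = vtx 23))
  | .mv s, .mv t => ∃ e ∈ MpEdges, s = vtx e.1 ∧ t = vtx e.2
  | _, _ => False

/-- The graph `J*_I`. -/
def JStar {n m : ℕ} (I : NAE n m) : SimpleGraph (JStarV n m) := fromRel (JStarRel I)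

/-- `b`-type vertices of `J_I^k`. -/
def JVK.isB {n m k : ℕ} : JVK n m k → Bool
  | .orig v => v.isB
  | _ => false

/-- A pendant vertex of `J_I^4 - B`: a vertex with exactly one neighbour among
the non-`b`-type vertices. -/
def PendantOutsideB {n m : ℕ} (I : NAE n m) (v : JVK n m 4) : Prop :=
  ∃! w : JVK n m 4, w.isB = false ∧ (JKGraph I 4).Adj v w


theorem J'Graph.exists_b_of_adj {n m : ℕ} {I : NAE n m} {u v : JV' n m}
    (huv : (J'Graph I).Adj u v) (hu : u.isAX = true) (hv : v.isC = false) :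
    ∃ j p h, v = .b j p h := by
  cases u <;> cases v <;> simp_all [J'Graph, J'Rel, JV'.isAX, JV'.isC]

theorem J'Graph.isAX_of_b_adj {n m : ℕ} {I : NAE n m} {v : JV' n m} {j : Fin m} {p : Bool}
    {h : Fin 2} (hb : (J'Graph I).Adj (.b j p h) v) : v.isAX = true := by
  cases v <;> simp_all [J'Graph, J'Rel, JV'.isAX]

/-- If a vertex of `a`- or `x`-type has a `b`-type neighbour and a `b`-type non-neighbour, then it
is of `a`-type, so all its `b`-type neighbours lie in its clause component. -/
theorem J'Graph.same_component {n m : ℕ} {I : NAE n m} {v : JV' n m} (hv : v.isAX = true)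
    {j j₁ j₂ : Fin m} {p p₁ p₂ : Bool} {h h₁ h₂ : Fin 2}
    (hn : ¬ (J'Graph I).Adj v (.b j p h))
    (h₁v : (J'Graph I).Adj v (.b j₁ p₁ h₁)) (h₂v : (J'Graph I).Adj v (.b j₂ p₂ h₂)) :
    j₁ = j₂ ∧ p₁ = p₂ := by
  cases v <;> simp_all [J'Graph, J'Rel, JV'.isAX]

/-- An induced path avoiding the `c`-type vertices whose first vertex has `a`- or `x`-type does not
have six vertices. -/
theorem J'Graph.not_isAX_of_embedding {n m : ℕ} {I : NAE n m}
    (f : pathGraph 6 ↪g J'Graph I) (hC : ∀ i, (f i).isC = false) :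
    (f 0).isAX ≠ true := by
  intro h0
  have adj (i j : Fin 6) : (J'Graph I).Adj (f i) (f j) ↔ i.val + 1 = j.val ∨ j.val + 1 = i.val := by
    rw [f.map_adj_iff, pathGraph_adj]
  obtain ⟨j₁, p₁, k₁, e₁⟩ := exists_b_of_adj ((adj 0 1).2 (by simp)) h0 (hC 1)
  have h2 : (f 2).isAX = true := isAX_of_b_adj (e₁ ▸ (adj 1 2).2 (by simp))
  obtain ⟨j₃, p₃, k₃, e₃⟩ := exists_b_of_adj ((adj 2 3).2 (by simp)) h2 (hC 3)
  have h4 : (f 4).isAX = true := isAX_of_b_adj (e₃ ▸ (adj 3 4).2 (by simp))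
  obtain ⟨j₅, p₅, k₅, e₅⟩ := exists_b_of_adj ((adj 4 5).2 (by simp)) h4 (hC 5)
  obtain ⟨rfl, rfl⟩ := same_component h2 (e₅ ▸ mt (adj 2 5).1 (by simp))
    (e₁ ▸ (adj 2 1).2 (by simp)) (e₃ ▸ (adj 2 3).2 (by simp))
  obtain ⟨rfl, rfl⟩ := same_component h4 (e₁ ▸ mt (adj 4 1).1 (by simp))
    (e₃ ▸ (adj 4 3).2 (by simp)) (e₅ ▸ (adj 4 5).2 (by simp))
  have h₁₃ : k₁ ≠ k₃ := by
    rintro rfl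
    exact absurd (f.injective (e₁.trans e₃.symm)) (by decide)
  have h₃₅ : k₃ ≠ k₅ := by
    rintro rfl
    exact absurd (f.injective (e₃.trans e₅.symm)) (by decide)
  have h₁₅ : k₁ ≠ k₅ := by
    rintro rfl
    exact absurd (f.injective (e₁.trans e₅.symm)) (by decide)
  omega

/-- The first `s` vertices of a path on `r` vertices induce a path. -/
def pathGraphInitial {s r : ℕ} (h : s ≤ r) : pathGraph s ↪g pathGraph r where
  toEmbedding := Fin.castLEEmb h
  map_rel_iff' := by simp [pathGraph_adj]

/-- The last `s` vertices of a path on `r` vertices, in reverse order, induce a path. -/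
def pathGraphFinalRev {s r : ℕ} (h : s ≤ r) : pathGraph s ↪g pathGraph r where
  toEmbedding := (Fin.castLEEmb h).trans Fin.revPerm.toEmbedding
  map_rel_iff' := by
    intro a b
    simp only [pathGraph_adj, Function.Embedding.trans_apply, Fin.castLEEmb_apply,
      Equiv.coe_toEmbedding, Fin.revPerm_apply, Fin.val_rev, Fin.val_castLE]
    omega

/- Statement 13 -/
theorem stmt13 {n m : ℕ} (I : NAE n m) (r : ℕ) (hr : 1 ≤ r)
    (f : pathGraph r ↪g J'Graph I) (hC : ∀ i, (f i).isC = false)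
    (hend : (f ⟨0, by omega⟩).isAX = true ∨ (f ⟨r - 1, by omega⟩).isAX = true) :
    r ≤ 5 := by
  by_contra! h6
  rcases hend with h | h
  · exact J'Graph.not_isAX_of_embedding (f.comp (pathGraphInitial h6)) (fun _ => hC _) h
  · exact J'Graph.not_isAX_of_embedding (f.comp (pathGraphFinalRev h6)) (fun _ => hC _) h
end

section
/- Every induced path in the graph J_I^4 − B (the graph obtained from J_I^4 by removing all b-type vertices) contains at most 7 vertices; if it contains at most one pendant vertex of J_I^4 − B then it contains at most 6 vertices; and if it contains no pendant vertex of J_I^4 − B then it contains at most 5 vertices. -/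
open SimpleGraph

namespace JVK

variable {n m : ℕ}

/-- Distance from the root of the component of `J_I^4 - B` containing the vertex, where the
`x`-type vertices are the roots (with junk values at `b`-type vertices and their pendants). -/
def depth : JVK n m 4 → ℕ
  | .orig (.x _) => 0
  | .orig (.c _ _ _) => 1
  | .orig (.a _ _ _) => 2
  | .orig (.b _ _ _) => 0
  | .pend (.x _) _ => 1
  | .pend (.c _ _ _) _ => 2
  | .pend (.a _ _ _) _ => 3
  | .pend (.b _ _ _) _ => 0

/-- The parent of a vertex in the rooted forest `J_I^4 - B`. -/
def parent (I : NAE n m) : JVK n m 4 → JVK n m 4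
  | .orig (.c j _ h) => .orig (.x (I.clause j h))
  | .orig (.a j p h) => .orig (.c j p h)
  | .pend v _ => .orig v
  | v => v

theorem depth_le (v : JVK n m 4) : v.depth ≤ 3 := by
  rcases v with (_ | _ | _ | _) | ⟨_ | _ | _ | _, _⟩ <;> simp [depth]

theorem depth_parent_of_adj (I : NAE n m) {u v : JVK n m 4} (hu : u.isB = false)
    (hv : v.isB = false) (h : (JKGraph I 4).Adj u v) :
    (u.depth = v.depth + 1 ∧ parent I u = v) ∨ (v.depth = u.depth + 1 ∧ parent I v = u) := by
  rcases u with (_ | _ | _ | _) | ⟨_ | _ | _ | _, _⟩ <;>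
  rcases v with (_ | _ | _ | _) | ⟨_ | _ | _ | _, _⟩ <;>
  simp_all [depth, parent, JKGraph, JKRel, J'Rel, isB, JV'.isB]

theorem pendantOutsideB_of_depth_eq (I : NAE n m) {u v : JVK n m 4} (hu : u.isB = false)
    (hv : v.isB = false) (h : (JKGraph I 4).Adj u v) (hd : u.depth = 3) :
    PendantOutsideB I u := by
  have parent_eq {w : JVK n m 4} (hw : w.isB = false) (h : (JKGraph I 4).Adj u w) :
      parent I u = w := by
    rcases depth_parent_of_adj I hu hw h with h | h
    · exact h.2
    · have := w.depth_le
      omega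
  exact ⟨v, ⟨hv, h⟩, fun w hw => (parent_eq hw.1 hw.2).symm.trans (parent_eq hv h)⟩

end JVK

/- Statement 14 -/
theorem stmt14 {n m : ℕ} (I : NAE n m) (r : ℕ)
    (f : pathGraph r ↪g JKGraph I 4) (hB : ∀ i, (f i).isB = false) :
    r ≤ 7 ∧
    ({i : Fin r | PendantOutsideB I (f i)}.Subsingleton → r ≤ 6) ∧
    ((∀ i, ¬ PendantOutsideB I (f i)) → r ≤ 5) := by
  have adj (i : ℕ) (hi : i + 1 < r) :
      (JKGraph I 4).Adj (f ⟨i, by omega⟩) (f ⟨i + 1, hi⟩) :=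
    f.map_adj_iff.2 (by simp [pathGraph_adj])
  obtain ⟨d, hd⟩ : ∃ d : ℕ → ℕ, ∀ i (hi : i < r), d i = (f ⟨i, hi⟩).depth :=
    ⟨fun i => if hi : i < r then (f ⟨i, hi⟩).depth else 0, fun i hi => dif_pos hi⟩
  have le (i : ℕ) (hi : i < r) : d i ≤ 3 := hd i hi ▸ JVK.depth_le _
  have step (i : ℕ) (hi : i + 1 < r) : d i = d (i + 1) + 1 ∨ d (i + 1) = d i + 1 := by
    rw [hd i (by omega), hd (i + 1) hi]
    exact (JVK.depth_parent_of_adj I (hB _) (hB _) (adj i hi)).imp And.left And.left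
  have up (i : ℕ) (hi : i + 2 < r) (h₁ : d (i + 1) = d i + 1) :
      d (i + 2) = d (i + 1) + 1 := by
    refine (step (i + 1) hi).resolve_left fun h₂ => ?_
    rw [hd i (by omega), hd (i + 1) (by omega)] at h₁
    rw [hd (i + 1) (by omega), hd (i + 1 + 1) hi] at h₂
    have e₁ := (JVK.depth_parent_of_adj I (hB _) (hB _) (adj i (by omega))).resolve_left
      fun h => by omega
    have e₂ := (JVK.depth_parent_of_adj I (hB _) (hB _) (adj (i + 1) hi)).resolve_right
      fun h => by omega
    have : i = i + 1 + 1 := congrArg Fin.val (f.injective (e₁.2.symm.trans e₂.2))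
    omega
  have pendant_left (h : 1 < r) (h₀ : d 0 = 3) : PendantOutsideB I (f ⟨0, by omega⟩) :=
    JVK.pendantOutsideB_of_depth_eq I (hB _) (hB _) (adj 0 h) (hd 0 (by omega) ▸ h₀)
  have pendant_right (i : ℕ) (hi : i + 1 < r) (h₀ : d (i + 1) = 3) :
      PendantOutsideB I (f ⟨i + 1, hi⟩) :=
    JVK.pendantOutsideB_of_depth_eq I (hB _) (hB _) (adj i hi).symm (hd (i + 1) hi ▸ h₀)
  have six (hr : 6 ≤ r) : d 0 = 3 ∨ d 5 = 3 := by
    have := le 0 (by omega)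
    have := le 5 (by omega)
    have s₀ := step 0 (by omega)
    have s₁ := step 1 (by omega)
    have s₂ := step 2 (by omega)
    have u₀ := up 0 (by omega)
    have u₁ := up 1 (by omega)
    have u₂ := up 2 (by omega)
    have u₃ := up 3 (by omega)
    simp only [Nat.reduceAdd] at *
    rcases s₂ with s₂ | s₂ <;> omega
  have seven (hr : 7 ≤ r) : d 0 = 3 ∧ d 6 = 3 := by
    have := le 0 (by omega)
    have := le 6 (by omega)
    have s₀ := step 0 (by omega)
    have s₁ := step 1 (by omega)
    have s₂ := step 2 (by omega)
    have s₃ := step 3 (by omega)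
    have u₀ := up 0 (by omega)
    have u₁ := up 1 (by omega)
    have u₂ := up 2 (by omega)
    have u₃ := up 3 (by omega)
    have u₄ := up 4 (by omega)
    simp only [Nat.reduceAdd] at *
    rcases s₃ with s₃ | s₃ <;> omega
  refine ⟨?_, fun hs => ?_, fun hn => ?_⟩
  · by_contra! hr
    have := seven (by omega)
    have := le 7 (by omega)
    have := le 5 (by omega)
    have s₅ := step 5 (by omega)
    have u₅ := up 5 (by omega)
    simp only [Nat.reduceAdd] at *
    omega
  · by_contra! hr
    obtain ⟨h₀, h₆⟩ := seven (by omega)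
    have e := hs (pendant_left (by omega) h₀) (pendant_right 5 (by omega) h₆)
    simp at e
  · by_contra! hr
    rcases six (by omega) with h | h
    · exact hn _ (pendant_left (by omega) h)
    · exact hn _ (pendant_right 4 (by omega) h)
end

section
/- The graph J*_I is (C_3, P_22)-free, that is, J*_I is triangle-free and contains no induced subgraph isomorphic to the path on 22 vertices. -/
open SimpleGraph

/-- Row `k` lists the kinds that can be adjacent to kind `k`. Kinds `1, …, 23` are the
vertices of `M'`; `24, 25, 26, 27` are the `a`-, `b`-, `c`- and `x`-type vertices; `27 + i` for
`i ∈ {1, 2, 3, 4}` are the pendant vertices of colour `i`. -/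
def nbrRows : List (List ℕ) :=
  [[], [2, 4, 7, 9, 13, 15, 18, 20], [1, 3, 6, 8, 12, 14, 17, 19, 25, 29, 30, 31], [2, 5, 7, 10,
   13, 16, 18, 21], [1, 5, 6, 10, 12, 16, 17, 21, 25, 28, 30, 31], [3, 4, 8, 9, 14, 15, 19, 20],
   [2, 4, 11, 13, 15, 22], [1, 3, 11, 12, 14, 22], [2, 5, 11, 13, 16, 22], [1, 5, 11, 12, 16,
   22], [3, 4, 11, 14, 15, 22], [6, 7, 8, 9, 10, 17, 18, 19, 20, 21, 26, 28, 29, 31], [2, 4, 7,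
   9, 23], [1, 3, 6, 8, 23], [2, 5, 7, 10, 23], [1, 5, 6, 10, 23], [3, 4, 8, 9, 23], [2, 4, 11],
   [1, 3, 11, 23], [2, 5, 11, 23], [1, 5, 11, 23], [3, 4, 11, 23], [6, 7, 8, 9, 10, 23], [12,
   13, 14, 15, 16, 18, 19, 20, 21, 22, 26, 28, 29, 30], [25, 26, 28, 29, 30, 31], [2, 4, 24,
   27], [11, 23, 24, 27], [25, 26, 28, 29, 30, 31], [4, 11, 23, 24, 27], [2, 11, 23, 24, 27],
   [2, 4, 23, 24, 27], [2, 4, 11, 24, 27]]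

/-- Row `k` is the bit mask of the kinds that a vertex distinct from and not adjacent to a vertex of
kind `k` can have. -/
def nonNbrRows : List ℕ :=
  [0x0, 0xffeb5d68, 0x1df5aeb0, 0xffdadb52, 0x2ddceb8c, 0xffe73cc6, 0xffbf57aa, 0xffbfa774,
   0xffbed6da, 0xffbee5dc, 0xffbf33e6, 0x4bc1f03e, 0xff7fed6a, 0xff7fdeb4, 0xff7fbb5a, 0xff7f7b9c,
   0xff7efce6, 0xfffdf7ea, 0xff7bf7f4, 0xff77f7da, 0xff6ff7dc, 0xff5ff7e6, 0xff3ff83e, 0x8b020ffe,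
   0xfffffffe, 0xf7ffffea, 0xff7ff7fe, 0xfdfffffe, 0xff7ff7ee, 0xff7ff7fa, 0xff7fffea, 0xfffff7ea]

/-- The kinds that can be adjacent to kind `k`. -/
def nbrs (k : ℕ) : List ℕ := nbrRows.getD k []

/-- The bit mask of the kinds that can be distinct from and non-adjacent to kind `k`. -/
def nonNbrMask (k : ℕ) : ℕ := nonNbrRows.getD k 0

/-- `blocked y z u v w` says that no induced path can have consecutive vertices of kinds
`y, z, u, v, w`, because `a`-type vertices have one `c`-type neighbour, `c`-type vertices have one
`a`-type and one `x`-type neighbour, pendant vertices have one owner, and clause components have two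
`b`-type vertices. -/
def blocked (y z u v w : ℕ) : Bool :=
  (v == 26 && u == w) || (v == 24 && u == 26 && w == 26) ||
    (Nat.ble 28 v && Nat.ble 24 u && Nat.ble 24 w) ||
    (v == 24 && w == 25 && u == 25 && z == 24 && y == 25)

/-- Exhaustive search showing that a sequence of kinds ending in `y, z, u, v` cannot be continued
inside the successive masks `ms`, where `al` is the mask of the kinds that are still allowed by the
vertices before the last one. -/
def noPath : List ℕ → ℕ → ℕ → ℕ → ℕ → ℕ → Bool
  | [], _, _, _, _, _ => false
  | m :: ms, al, y, z, u, v =>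
    (nbrs v).all fun w =>
      !(Nat.land al m).testBit w || blocked y z u v w ||
        noPath ms (Nat.land al (nonNbrMask v)) z u v w

/-- The mask of all kinds. -/
def allKinds : ℕ := 0xfffffffe

/-- The mask of all kinds except those of the vertices `t₁, t₂, t₃, t₄` of `M'`. -/
def kindsOffT : ℕ := 0xff7ff7ea

theorem noPath_of_mem_T :
    [2, 4, 11, 23].all (noPath (List.replicate 15 allKinds) allKinds 0 0 0) = true := by
  decide +kernel

theorem noPath_of_ends_off_T :
    (List.range 32).all (fun s => !kindsOffT.testBit s ||
      noPath (List.replicate 6 kindsOffT ++ List.replicate 8 allKinds ++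
        List.replicate 7 kindsOffT) allKinds 0 0 0 s) = true := by
  decide +kernel

theorem testBit_allKinds {k : ℕ} (h : 0 < k) (h' : k < 32) : allKinds.testBit k = true := by
  interval_cases k <;> rfl

theorem mem_T_or_testBit_kindsOffT {k : ℕ} (h : 0 < k) (h' : k < 32) :
    k ∈ [2, 4, 11, 23] ∨ kindsOffT.testBit k = true := by
  interval_cases k <;> decide

theorem nbrs_triangle_free : ∀ k ∈ List.range 32, ∀ l ∈ nbrs k, ∀ r ∈ nbrs l, k ∉ nbrs r := by
  decide +kernel

/-- The kind of a vertex of `J*_I`, as an index into `nbrRows`. -/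
def JStarV.kind {n m : ℕ} : JStarV n m → ℕ
  | .orig (.a _ _ _) => 24
  | .orig (.b _ _ _) => 25
  | .orig (.c _ _ _) => 26
  | .orig (.x _) => 27
  | .pend v i _ => 27 + cW4 v i
  | .mv t => t.val + 1

theorem length_complList {n m : ℕ} (v : JV' n m) :
    (complList v).length = 4 - (L'assign v).card := by
  rcases v with ⟨j, p, h⟩ | _ | _ | _
  · cases p <;> fin_cases h <;> rfl
  all_goals rfl

theorem cW4_mem {n m : ℕ} (v : JV' n m) (i : Fin (4 - (L'assign v).card)) :
    cW4 v i ∈ [1, 2, 3, 4] := by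
  have hi : i.val < (complList v).length := by
    rw [length_complList]
    exact i.isLt
  have hsub : complList v ⊆ [1, 2, 3, 4] := by
    rcases v with ⟨j, p, h⟩ | _ | _ | _
    · cases p <;> fin_cases h <;> simp [complList]
    all_goals simp [complList]
  rw [cW4, List.getD_eq_getElem _ _ hi]
  exact hsub (List.getElem_mem hi)

theorem cW4_pos {n m : ℕ} (v : JV' n m) (i : Fin (4 - (L'assign v).card)) : 0 < cW4 v i := by
  have := cW4_mem v i
  simp only [List.mem_cons, List.not_mem_nil, or_false] at this
  omega

namespace JStarV

theorem kind_pos {n m : ℕ} (u : JStarV n m) : 0 < u.kind := by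
  rcases u with (_ | _ | _ | _) | _ | _ <;> simp [kind]

theorem kind_lt {n m : ℕ} (u : JStarV n m) : u.kind < 32 := by
  rcases u with (_ | _ | _ | _) | ⟨v, i, hv⟩ | t
  all_goals simp only [kind]; try omega
  have := cW4_mem v i
  simp only [List.mem_cons, List.not_mem_nil, or_false] at this
  omega

end JStarV

/-- Two distinct vertices of kinds `k` and `l` may be adjacent if `R` holds, and may be non-adjacent
if `R` fails. -/
def KindsMatch (R : Prop) (k l : ℕ) : Prop :=
  (R → l ∈ nbrs k ∧ k ∈ nbrs l) ∧
    (¬R → (nonNbrMask k).testBit l = true ∧ (nonNbrMask l).testBit k = true)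

instance (R : Prop) [Decidable R] (k l : ℕ) : Decidable (KindsMatch R k l) := by
  unfold KindsMatch
  infer_instance

theorem KindsMatch.symm {R S : Prop} {k l : ℕ} (h : KindsMatch R k l) (hRS : R ↔ S) :
    KindsMatch S l k := by
  simp only [KindsMatch, hRS] at h ⊢
  exact ⟨fun hS => (h.1 hS).symm, fun hS => (h.2 hS).symm⟩

theorem kindsMatch_mv_mv : ∀ s t : Fin 23, s ≠ t →
    KindsMatch ((∃ e ∈ MpEdges, s = vtx e.1 ∧ t = vtx e.2) ∨
      ∃ e ∈ MpEdges, t = vtx e.1 ∧ s = vtx e.2) (s.val + 1) (t.val + 1) := by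
  decide +kernel

theorem kindsMatch_pend_mv : ∀ k ∈ [1, 2, 3, 4], ∀ t : Fin 23,
    KindsMatch (∃ j ∈ ({1, 2, 3, 4} : Finset ℕ), j ≠ k ∧ t = tvert j) (27 + k) (t.val + 1) := by
  decide +kernel

theorem kindsMatch_orig_mv : ∀ q ∈ [(24, false, false), (25, true, false), (26, false, true),
      (27, false, false)], ∀ t : Fin 23,
    KindsMatch ((q.2.1 = true ∧ (t = vtx 2 ∨ t = vtx 4)) ∨
      (q.2.2 = true ∧ (t = vtx 11 ∨ t = vtx 23))) q.1 (t.val + 1) := by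
  decide +kernel

theorem kindsMatch_of_ge {R : Prop} {k l : ℕ} (hk : 24 ≤ k) (hk' : k < 32) (hl : 24 ≤ l)
    (hl' : l < 32) (hR : R → l ∈ nbrs k ∧ k ∈ nbrs l)
    (hbx : k = 25 ∧ l = 27 ∨ k = 27 ∧ l = 25 → R) : KindsMatch R k l := by
  refine ⟨hR, fun h => ?_⟩
  replace hbx := fun h' => h (hbx h')
  clear h hR
  revert hbx
  interval_cases k <;> interval_cases l <;> decide

theorem kinds_of_pend_orig : ∀ k ∈ [1, 2, 3, 4], ∀ l ∈ [24, 27],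
    l ∈ nbrs (27 + k) ∧ 27 + k ∈ nbrs l := by
  decide

namespace JStarV

variable {n m : ℕ} (I : NAE n m)

theorem adj_iff {u v : JStarV n m} :
    (JStar I).Adj u v ↔ u ≠ v ∧ (JStarRel I u v ∨ JStarRel I v u) := Iff.rfl

theorem adj_orig_orig {u v : JV' n m} :
    (JStar I).Adj (.orig u) (.orig v) ↔ u ≠ v ∧ (J'Rel I u v ∨ J'Rel I v u) := by
  simp [adj_iff, JStarRel]

theorem adj_orig_mv {u : JV' n m} {t : Fin 23} :
    (JStar I).Adj (.orig u) (.mv t) ↔ (u.isB = true ∧ (t = vtx 2 ∨ t = vtx 4)) ∨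
      (u.isC = true ∧ (t = vtx 11 ∨ t = vtx 23)) := by
  simp [adj_iff, JStarRel]

theorem adj_pend_mv {v : JV' n m} {i : Fin (4 - (L'assign v).card)} {hv : v.isAX = true}
    {t : Fin 23} : (JStar I).Adj (.pend v i hv) (.mv t) ↔
      ∃ j ∈ ({1, 2, 3, 4} : Finset ℕ), j ≠ cW4 v i ∧ t = tvert j := by
  simp [adj_iff, JStarRel]

theorem adj_pend_orig {v : JV' n m} {i : Fin (4 - (L'assign v).card)} {hv : v.isAX = true}
    {u : JV' n m} : (JStar I).Adj (.pend v i hv) (.orig u) ↔ u = v := by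
  simp [adj_iff, JStarRel, eq_comm]

theorem not_adj_pend_pend {u v : JV' n m} {i : Fin (4 - (L'assign u).card)}
    {j : Fin (4 - (L'assign v).card)} {hu : u.isAX = true} {hv : v.isAX = true} :
    ¬(JStar I).Adj (.pend u i hu) (.pend v j hv) := by
  simp [adj_iff, JStarRel]

theorem kindsMatch_orig_mv (u : JV' n m) (t : Fin 23) :
    KindsMatch ((JStar I).Adj (.orig u) (.mv t)) (kind (.orig u : JStarV n m)) (t.val + 1) := by
  rw [adj_orig_mv]
  cases u
  · exact _root_.kindsMatch_orig_mv (24, false, false) (by decide) t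
  · exact _root_.kindsMatch_orig_mv (25, true, false) (by decide) t
  · exact _root_.kindsMatch_orig_mv (27, false, false) (by decide) t
  · exact _root_.kindsMatch_orig_mv (26, false, true) (by decide) t

theorem kindsMatch_pend_mv (v : JV' n m) (i : Fin (4 - (L'assign v).card)) (hv : v.isAX = true)
    (t : Fin 23) : KindsMatch ((JStar I).Adj (.pend v i hv) (.mv t))
      (kind (.pend v i hv : JStarV n m)) (t.val + 1) := by
  rw [adj_pend_mv]
  exact _root_.kindsMatch_pend_mv _ (cW4_mem v i) t

theorem kindsMatch_pend_orig (v : JV' n m) (i : Fin (4 - (L'assign v).card)) (hv : v.isAX = true)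
    (u : JV' n m) : KindsMatch ((JStar I).Adj (.pend v i hv) (.orig u))
      (kind (.pend v i hv : JStarV n m)) (kind (.orig u : JStarV n m)) := by
  have hc := cW4_mem v i
  have hpos := cW4_pos v i
  refine kindsMatch_of_ge (by simp only [kind]; omega) (kind_lt _)
    (by cases u <;> simp [kind]) (kind_lt _)
    ?_ ?_
  · rw [adj_pend_orig]
    rintro rfl
    cases u
    · exact kinds_of_pend_orig _ hc 24 (by decide)
    · cases hv
    · exact kinds_of_pend_orig _ hc 27 (by decide)
    · cases hv
  · simp only [kind]
    omega

theorem kindsMatch_pend_pend (u v : JV' n m) (i : Fin (4 - (L'assign u).card))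
    (j : Fin (4 - (L'assign v).card)) (hu : u.isAX = true) (hv : v.isAX = true) :
    KindsMatch ((JStar I).Adj (.pend u i hu) (.pend v j hv))
      (kind (.pend u i hu : JStarV n m)) (kind (.pend v j hv : JStarV n m)) := by
  have hc := cW4_pos u i
  have hd := cW4_pos v j
  refine kindsMatch_of_ge (by simp only [kind]; omega) (kind_lt _)
    (by simp only [kind]; omega) (kind_lt _)
    (fun h => (not_adj_pend_pend I h).elim) ?_
  simp only [kind]
  omega

theorem kindsMatch_orig_orig (u v : JV' n m) :
    KindsMatch ((JStar I).Adj (.orig u) (.orig v))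
      (kind (.orig u : JStarV n m)) (kind (.orig v : JStarV n m)) := by
  rw [adj_orig_orig]
  refine kindsMatch_of_ge (by cases u <;> simp [kind]) (kind_lt _) (by cases v <;> simp [kind])
    (kind_lt _) ?_ ?_
  · cases u <;> cases v <;> simp [J'Rel, kind, nbrs, nbrRows]
  · cases u <;> cases v <;> simp [J'Rel, kind]

/-- Adjacency in `J*_I` is compatible with the adjacency tables of kinds. -/
theorem kindsMatch {u v : JStarV n m} (huv : u ≠ v) :
    KindsMatch ((JStar I).Adj u v) u.kind v.kind := by
  rcases u with u | ⟨u, i, hu⟩ | s <;> rcases v with v | ⟨v, j, hv⟩ | t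
  · exact kindsMatch_orig_orig I u v
  · exact (kindsMatch_pend_orig I v j hv u).symm ((JStar I).adj_comm _ _)
  · exact kindsMatch_orig_mv I u t
  · exact kindsMatch_pend_orig I u i hu v
  · exact kindsMatch_pend_pend I u v i j hu hv
  · exact kindsMatch_pend_mv I u i hu t
  · exact (kindsMatch_orig_mv I v s).symm ((JStar I).adj_comm _ _)
  · exact (kindsMatch_pend_mv I v j hv s).symm ((JStar I).adj_comm _ _)
  · rw [adj_iff, and_iff_right huv]
    exact kindsMatch_mv_mv s t (by simpa using huv)

end JStarV

/-- `g 0, …, g (L - 1)` are the consecutive vertices of an induced path of `G`. -/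
structure IsInducedPath {V : Type*} (G : SimpleGraph V) (L : ℕ) (g : ℕ → V) : Prop where
  inj : ∀ i < L, ∀ j < L, g i = g j → i = j
  adj : ∀ i < L, ∀ j < L, (G.Adj (g i) (g j) ↔ i + 1 = j ∨ j + 1 = i)

namespace IsInducedPath

variable {V : Type*} {G : SimpleGraph V} {L : ℕ} {g : ℕ → V}

theorem of_embedding (f : pathGraph (L + 1) ↪g G) :
    IsInducedPath G (L + 1) fun i => f (Fin.ofNat (L + 1) i) where
  inj i hi j hj h := by
    simpa [Fin.ext_iff, Nat.mod_eq_of_lt hi, Nat.mod_eq_of_lt hj] using f.injective h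
  adj i hi j hj := by
    simp [pathGraph_adj, Nat.mod_eq_of_lt hi, Nat.mod_eq_of_lt hj]

theorem shift (h : IsInducedPath G L g) {s M : ℕ} (hM : s + M ≤ L) :
    IsInducedPath G M fun i => g (s + i) where
  inj i hi j hj hij := by
    have := h.inj (s + i) (by omega) (s + j) (by omega) hij
    omega
  adj i hi j hj := by
    rw [h.adj (s + i) (by omega) (s + j) (by omega)]
    omega

theorem reverse (h : IsInducedPath G L g) : IsInducedPath G L fun i => g (L - 1 - i) where
  inj i hi j hj hij := by
    have := h.inj (L - 1 - i) (by omega) (L - 1 - j) (by omega) hij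
    omega
  adj i hi j hj := by
    rw [h.adj (L - 1 - i) (by omega) (L - 1 - j) (by omega)]
    omega

theorem adj_succ (h : IsInducedPath G L g) {i : ℕ} (hi : i + 1 < L) :
    G.Adj (g i) (g (i + 1)) :=
  (h.adj i (by omega) (i + 1) hi).2 (Or.inl rfl)

theorem ne (h : IsInducedPath G L g) {i j : ℕ} (hi : i < L) (hj : j < L) (hij : i ≠ j) :
    g i ≠ g j :=
  fun hg => hij (h.inj i hi j hj hg)

end IsInducedPath

namespace JStarV

variable {n m : ℕ} {I : NAE n m} {u v w : JStarV n m}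

theorem kind_eq_a (h : u.kind = 24) : ∃ j p k, u = .orig (.a j p k) := by
  rcases u with (_ | _ | _ | _) | ⟨v, i, _⟩ | t <;> simp only [kind] at h
  any_goals omega
  · exact ⟨_, _, _, rfl⟩

theorem kind_eq_b (h : u.kind = 25) : ∃ j p k, u = .orig (.b j p k) := by
  rcases u with (_ | _ | _ | _) | ⟨v, i, _⟩ | t <;> simp only [kind] at h
  any_goals omega
  · exact ⟨_, _, _, rfl⟩

theorem kind_eq_c (h : u.kind = 26) : ∃ j p k, u = .orig (.c j p k) := by
  rcases u with (_ | _ | _ | _) | ⟨v, i, _⟩ | t <;> simp only [kind] at h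
  any_goals omega
  · exact ⟨_, _, _, rfl⟩

theorem eq_of_adj_orig_c {j : Fin m} {p : Bool} {k : Fin 3}
    (h : (JStar I).Adj (.orig (.c j p k)) u) :
    u = .orig (.a j p k) ∨ u = .orig (.x (I.clause j k)) ∨ ∃ t, u = .mv t := by
  rcases u with (_ | _ | _ | _) | ⟨v, i, hv⟩ | t
  case pend =>
    obtain rfl := (adj_pend_orig I).1 h.symm
    cases hv
  case mv => exact Or.inr (Or.inr ⟨t, rfl⟩)
  all_goals simp_all [adj_orig_orig, J'Rel]

/-- Distinct neighbours of a `c`-type vertex have distinct kinds. -/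
theorem eq_of_adj_c (hv : v.kind = 26) (hu : (JStar I).Adj u v) (hw : (JStar I).Adj v w)
    (huw : u.kind = w.kind) : u = w := by
  obtain ⟨j, p, k, rfl⟩ := kind_eq_c hv
  obtain rfl | rfl | ⟨s, rfl⟩ := eq_of_adj_orig_c hu.symm <;>
    obtain rfl | rfl | ⟨t, rfl⟩ := eq_of_adj_orig_c hw <;>
    simp only [kind] at huw <;> first | rfl | omega | (congr 1; omega)

/-- An `a`-type vertex has at most one `c`-type neighbour. -/
theorem eq_of_adj_a (hv : v.kind = 24) (hu : (JStar I).Adj u v) (hw : (JStar I).Adj v w)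
    (huc : u.kind = 26) (hwc : w.kind = 26) : u = w := by
  obtain ⟨j, p, k, rfl⟩ := kind_eq_a hv
  obtain ⟨j', p', k', rfl⟩ := kind_eq_c huc
  obtain ⟨j'', p'', k'', rfl⟩ := kind_eq_c hwc
  simp_all [adj_orig_orig, J'Rel]

/-- A pendant vertex has at most one neighbour outside `M'`. -/
theorem eq_of_adj_pend (hv : 28 ≤ v.kind) (hu : (JStar I).Adj u v) (hw : (JStar I).Adj v w)
    (hu24 : 24 ≤ u.kind) (hw24 : 24 ≤ w.kind) : u = w := by
  rcases v with v | ⟨v, i, hv'⟩ | t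
  · cases v <;> simp [kind] at hv
  · rcases u with u | _ | t
    · rcases w with w | _ | t
      · rw [(adj_pend_orig I).1 hu.symm, (adj_pend_orig I).1 hw]
      · exact (not_adj_pend_pend I hw).elim
      · simp only [kind] at hw24; omega
    · exact (not_adj_pend_pend I hu).elim
    · simp only [kind] at hu24; omega
  · simp only [kind] at hv; omega

/-- Adjacent vertices of types `a` and `b` lie in the same clause component, which has only two
`b`-type vertices. -/
theorem not_baabab {b₁ a₁ b₂ a₂ b₃ : JStarV n m} (hb₁ : b₁.kind = 25) (ha₁ : a₁.kind = 24)
    (hb₂ : b₂.kind = 25) (ha₂ : a₂.kind = 24) (hb₃ : b₃.kind = 25)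
    (h₁ : (JStar I).Adj b₁ a₁) (h₂ : (JStar I).Adj a₁ b₂) (h₃ : (JStar I).Adj b₂ a₂)
    (h₄ : (JStar I).Adj a₂ b₃) (h₁₂ : b₁ ≠ b₂) (h₁₃ : b₁ ≠ b₃) (h₂₃ : b₂ ≠ b₃) : False := by
  obtain ⟨_, _, k₁, rfl⟩ := kind_eq_b hb₁
  obtain ⟨_, _, _, rfl⟩ := kind_eq_a ha₁
  obtain ⟨_, _, k₂, rfl⟩ := kind_eq_b hb₂
  obtain ⟨_, _, _, rfl⟩ := kind_eq_a ha₂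
  obtain ⟨_, _, k₃, rfl⟩ := kind_eq_b hb₃
  simp only [adj_orig_orig, J'Rel, or_false, false_or] at h₁ h₂ h₃ h₄
  obtain ⟨-, rfl, rfl, -⟩ := h₁
  obtain ⟨-, rfl, rfl, -⟩ := h₂
  obtain ⟨-, rfl, rfl, -⟩ := h₃
  obtain ⟨-, rfl, rfl, -⟩ := h₄
  simp only [ne_eq, orig.injEq, JV'.b.injEq, true_and] at h₁₂ h₁₃ h₂₃
  omega

end JStarV

/-- The kind of the vertex `d` steps before `g i`, or `0` if there is none. -/
def kindBefore {n m : ℕ} (g : ℕ → JStarV n m) (d i : ℕ) : ℕ :=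
  if d ≤ i then (g (i - d)).kind else 0

namespace IsInducedPath

variable {n m : ℕ} {I : NAE n m} {L : ℕ} {g : ℕ → JStarV n m}

theorem kindBefore_succ (d i : ℕ) : kindBefore g (d + 1) (i + 1) = kindBefore g d i := by
  simp [kindBefore]

theorem le_of_kindBefore_pos {d i : ℕ} (h : 0 < kindBefore g d i) : d ≤ i := by
  by_contra hd
  simp [kindBefore, hd] at h

theorem not_blocked (h : IsInducedPath (JStar I) L g) {i : ℕ} (hi : i + 1 < L) :
    blocked (kindBefore g 3 i) (kindBefore g 2 i) (kindBefore g 1 i) (g i).kind (g (i + 1)).kind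
      = false := by
  rw [Bool.eq_false_iff]
  intro hb
  have hpos := (g (i + 1)).kind_pos
  have hu : 0 < kindBefore g 1 i := by
    by_contra h0
    simp only [Nat.not_lt, Nat.le_zero] at h0
    simp [blocked, h0, hpos.ne] at hb
  obtain ⟨i, rfl⟩ := Nat.exists_eq_add_of_le' (le_of_kindBefore_pos hu)
  have h₁ := h.adj_succ (i := i) (by omega)
  have h₂ := h.adj_succ (i := i + 1) hi
  have hne := h.ne (i := i) (j := i + 1 + 1) (by omega) hi (by omega)
  rw [kindBefore_succ, kindBefore_succ, kindBefore_succ] at hb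
  have h0 : kindBefore g 0 i = (g i).kind := by simp [kindBefore]
  rw [h0] at hb
  simp only [blocked, Bool.or_eq_true, Bool.and_eq_true, beq_iff_eq, Nat.ble_eq] at hb
  obtain ((⟨hv, huw⟩ | ⟨⟨hv, hu⟩, hw⟩) | ⟨⟨hv, hu⟩, hw⟩) | ⟨⟨⟨⟨hv, hw⟩, hu⟩, hz⟩, hy⟩ := hb
  · exact hne (JStarV.eq_of_adj_c hv h₁ h₂ huw)
  · exact hne (JStarV.eq_of_adj_a hv h₁ h₂ hu hw)
  · exact hne (JStarV.eq_of_adj_pend hv h₁ h₂ hu hw)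
  · obtain ⟨i, rfl⟩ := Nat.exists_eq_add_of_le'
      (le_of_kindBefore_pos (by omega : 0 < kindBefore g 2 i))
    simp only [kindBefore, Nat.le_add_left, if_true, Nat.add_sub_cancel,
      show i + 2 - 1 = i + 1 by omega, show 1 ≤ i + 2 by omega] at hz hy
    exact JStarV.not_baabab hy hz hu hv hw (h.adj_succ (by omega)) (h.adj_succ (by omega)) h₁ h₂
      (h.ne (by omega) (by omega) (by omega)) (h.ne (by omega) (by omega) (by omega)) hne

theorem noPath_eq_false (h : IsInducedPath (JStar I) L g) (ms : List ℕ) :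
    ∀ i al : ℕ, i + ms.length < L →
      (∀ k (hk : k < ms.length), ms[k].testBit (g (i + 1 + k)).kind = true) →
      (∀ j, i < j → j < L → al.testBit (g j).kind = true) →
      noPath ms al (kindBefore g 3 i) (kindBefore g 2 i) (kindBefore g 1 i) (g i).kind = false := by
  induction ms with
  | nil => intros; rfl
  | cons a ms ih =>
    intro i al hL hms hal
    simp only [List.length_cons] at hL
    rw [noPath, List.all_eq_false]
    have hadj := h.adj_succ (i := i) (by omega)
    refine ⟨_, ((JStarV.kindsMatch I hadj.ne).1 hadj).1, ?_⟩
    have hrec := ih (i + 1) (Nat.land al (nonNbrMask (g i).kind)) (by omega)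
      (fun k hk => ?_) (fun j hj hjL => ?_)
    · rw [kindBefore_succ, kindBefore_succ, kindBefore_succ] at hrec
      have h0 : kindBefore g 0 i = (g i).kind := by simp [kindBefore]
      rw [h0] at hrec
      have hbit : (Nat.land al a).testBit (g (i + 1)).kind = true := by
        change (al &&& a).testBit _ = true
        rw [Nat.testBit_and, hal (i + 1) (by omega) (by omega), Bool.true_and]
        exact hms 0 (by simp)
      rw [hrec, hbit, h.not_blocked (by omega)]
      simp
    · have := hms (k + 1) (by simpa using hk)
      rwa [List.getElem_cons_succ, show i + 1 + (k + 1) = i + 1 + 1 + k by omega] at this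
    · change (al &&& nonNbrMask _).testBit _ = true
      rw [Nat.testBit_and, hal j (by omega) hjL, Bool.true_and]
      refine ((JStarV.kindsMatch I (h.ne (by omega) hjL (by omega))).2 ?_).1
      rw [h.adj i (by omega) j hjL]
      omega

theorem noPath_zero_eq_false (h : IsInducedPath (JStar I) L g) (ms : List ℕ) (hL : ms.length < L)
    (hms : ∀ k (hk : k < ms.length), ms[k].testBit (g (k + 1)).kind = true) :
    noPath ms allKinds 0 0 0 (g 0).kind = false := by
  refine h.noPath_eq_false ms 0 allKinds (by omega) (fun k hk => ?_)
    (fun j _ _ => testBit_allKinds (g j).kind_pos (g j).kind_lt)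
  rw [Nat.zero_add, Nat.add_comm]
  exact hms k hk

/-- An induced path with at least `16` vertices does not start at one of `t₁, t₂, t₃, t₄`. -/
theorem testBit_kindsOffT_zero (h : IsInducedPath (JStar I) L g) (hL : 16 ≤ L) :
    kindsOffT.testBit (g 0).kind = true := by
  refine mem_T_or_testBit_kindsOffT (g 0).kind_pos (g 0).kind_lt |>.resolve_left fun hT => ?_
  have := h.noPath_zero_eq_false (List.replicate 15 allKinds) (by simp; omega) fun k hk => by
    rw [List.getElem_replicate]
    exact testBit_allKinds (g _).kind_pos (g _).kind_lt
  rw [List.all_eq_true.1 noPath_of_mem_T _ hT] at this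
  cases this

theorem testBit_kindsOffT_of_le (h : IsInducedPath (JStar I) L g) {i : ℕ} (hi : i + 16 ≤ L) :
    kindsOffT.testBit (g i).kind = true :=
  (h.shift (s := i) (M := L - i) (by omega)).testBit_kindsOffT_zero (by omega)

theorem testBit_kindsOffT_of_ge (h : IsInducedPath (JStar I) L g) {i : ℕ} (hi : 15 ≤ i)
    (hiL : i < L) : kindsOffT.testBit (g i).kind = true := by
  have := h.reverse.testBit_kindsOffT_of_le (i := L - 1 - i) (by omega)
  rwa [show L - 1 - (L - 1 - i) = i by omega] at this

end IsInducedPath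

theorem not_isInducedPath_JStar {n m : ℕ} (I : NAE n m) (g : ℕ → JStarV n m) :
    ¬IsInducedPath (JStar I) 22 g := by
  intro h
  have hfalse := h.noPath_zero_eq_false (List.replicate 6 kindsOffT ++
    List.replicate 8 allKinds ++ List.replicate 7 kindsOffT) (by simp) fun k hk => by
      simp only [List.length_append, List.length_replicate] at hk
      simp only [List.getElem_append, List.getElem_replicate, List.length_append,
        List.length_replicate]
      split_ifs
      · exact h.testBit_kindsOffT_of_le (by omega)
      · exact testBit_allKinds (g _).kind_pos (g _).kind_lt
      · exact h.testBit_kindsOffT_of_ge (by omega) (by omega)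
  have := List.all_eq_true.1 noPath_of_ends_off_T _ (List.mem_range.2 (g 0).kind_lt)
  rw [h.testBit_kindsOffT_zero (by omega), hfalse] at this
  cases this

/- Statement 15 -/
theorem stmt15 {n m : ℕ} (I : NAE n m) :
    IsEmpty (cycleGraph 3 ↪g JStar I) ∧ IsEmpty (pathGraph 22 ↪g JStar I) := by
  refine ⟨⟨fun f => ?_⟩, ⟨fun f => not_isInducedPath_JStar I _ (.of_embedding f)⟩⟩
  have hmem {i j : Fin 3} (hij : i ≠ j) : (f j).kind ∈ nbrs (f i).kind := by
    have hadj : (JStar I).Adj (f i) (f j) := by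
      rw [f.map_adj_iff, cycleGraph_three_eq_top]
      exact hij
    exact ((JStarV.kindsMatch I hadj.ne).1 hadj).1
  exact nbrs_triangle_free _ (List.mem_range.2 (f 0).kind_lt) _ (hmem (j := 1) (by decide)) _
    (hmem (j := 2) (by decide)) (hmem (by decide))
end

section
/- For every pair of integers g ≥ 3 and k ≥ 3, there exists a finite simple graph whose girth is equal to g and whose chromatic number is equal to k. -/
open SimpleGraph

theorem card_filter_forall_eq_mul_le {ι P X : Type*} [Fintype ι] [Fintype P] [Fintype X]
    [DecidableEq P] [DecidableEq X] {p : ι → P} (hp : p.Injective) (t : ι → X) :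
    (Finset.univ.filter fun f : P → X => ∀ j, f (p j) = t j).card *
      Fintype.card X ^ Fintype.card ι ≤ Fintype.card X ^ Fintype.card P := by
  classical
  rw [← Fintype.card_fun, ← Fintype.card_fun, ← Finset.card_univ, ← Finset.card_product,
    ← Finset.card_univ]
  refine Finset.card_le_card_of_injOn (fun x => Function.extend p x.2 x.1) (by simp) ?_
  rintro ⟨f, h⟩ hf ⟨f', h'⟩ hf' he
  simp only [Finset.coe_product, Set.mem_prod, Finset.mem_coe, Finset.mem_filter] at hf hf'
  refine Prod.ext (funext fun a => ?_) (funext fun j => ?_)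
  · by_cases ha : ∃ j, p j = a
    · obtain ⟨j, rfl⟩ := ha
      exact (hf.1.2 j).trans (hf'.1.2 j).symm
    · simpa [Function.extend_apply' _ _ _ ha] using congrFun he a
  · simpa [hp.extend_apply] using congrFun he (p j)

/-- The graph in which each `x` is joined to its out-neighbours `f (x, i)`. -/
def outGraph {V I : Type*} (f : V × I → V) : SimpleGraph V :=
  fromRel fun x y => ∃ i, f (x, i) = y

/-- The closed walk `v`, whose step from `v j` to `v (j + 1)` is labelled `i j` and is directed
forward exactly when `b j` holds, is present in `f`. -/
def IsTraced {V I : Type*} {m : ℕ} (f : V × I → V)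
    (c : (Fin (m + 3) → V) × (Fin (m + 3) → I) × (Fin (m + 3) → Bool)) : Prop :=
  ∀ j, f (if c.2.2 j then c.1 j else c.1 (j + 1), c.2.1 j) =
    if c.2.2 j then c.1 (j + 1) else c.1 j

theorem card_filter_isTraced_mul_le {V I : Type*} [Fintype V] [Fintype I] [DecidableEq V]
    [DecidableEq I] {m : ℕ}
    (c : (Fin (m + 3) → V) × (Fin (m + 3) → I) × (Fin (m + 3) → Bool)) (hc : c.1.Injective)
    [DecidablePred fun f : V × I → V => IsTraced f c] :
    (Finset.univ.filter fun f : V × I → V => IsTraced f c).card * Fintype.card V ^ (m + 3) ≤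
      Fintype.card V ^ Fintype.card (V × I) := by
  classical
  by_cases hp : Function.Injective fun j => (if c.2.2 j then c.1 j else c.1 (j + 1), c.2.1 j)
  · convert card_filter_forall_eq_mul_le hp (fun j => if c.2.2 j then c.1 (j + 1) else c.1 j)
    · exact Iff.rfl
    · exact (Fintype.card_fin _).symm
  · suffices h : (Finset.univ.filter fun f : V × I → V => IsTraced f c) = ∅ by simp [h]
    refine Finset.filter_eq_empty_iff.2 fun f _ hf => hp fun j j' hjj => ?_
    have htgt := (hf j).symm.trans ((congrArg f hjj).trans (hf j'))
    have hsrc := congrArg Prod.fst hjj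
    have h2 : ∀ x : Fin (m + 3), x + 1 + 1 ≠ x := fun x hx => by
      rw [add_assoc, add_eq_left] at hx
      simp only [Fin.ext_iff, Fin.val_add, Fin.val_one, Fin.val_zero, Nat.reduceAdd] at hx
      rw [Nat.mod_eq_of_lt (by lia)] at hx
      lia
    cases hb : c.2.2 j <;> cases hb' : c.2.2 j' <;>
      simp only [hb, hb', if_true, if_false, Bool.false_eq_true, hc.eq_iff] at hsrc htgt
    · exact htgt
    · exact (h2 j (by rw [hsrc, htgt])).elim
    · exact (h2 j' (by rw [← hsrc, htgt])).elim
    · exact hsrc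

open scoped Classical in
/-- The injective closed walks of length `m + 3` present in `f`. -/
noncomputable def tracedCycles {V I : Type*} [Fintype V] [Fintype I] (f : V × I → V) (m : ℕ) :
    Finset ((Fin (m + 3) → V) × (Fin (m + 3) → I) × (Fin (m + 3) → Bool)) :=
  Finset.univ.filter fun c => c.1.Injective ∧ IsTraced f c

theorem sum_card_tracedCycles_le {V I : Type*} [Fintype V] [Fintype I] [Nonempty V]
    [DecidableEq V] [DecidableEq I] (m : ℕ) :
    ∑ f : V × I → V, (tracedCycles f m).card ≤
      (2 * Fintype.card I) ^ (m + 3) * Fintype.card V ^ Fintype.card (V × I) := by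
  classical
  have hpos : 0 < Fintype.card V ^ (m + 3) := pow_pos Fintype.card_pos _
  refine le_of_mul_le_mul_right ?_ hpos
  have hswap : ∑ f : V × I → V, (tracedCycles f m).card =
      ∑ c : (Fin (m + 3) → V) × (Fin (m + 3) → I) × (Fin (m + 3) → Bool),
        (Finset.univ.filter fun f : V × I → V => c.1.Injective ∧ IsTraced f c).card := by
    convert Finset.sum_card_bipartiteAbove_eq_sum_card_bipartiteBelow
      fun (f : V × I → V)
        (c : (Fin (m + 3) → V) × (Fin (m + 3) → I) × (Fin (m + 3) → Bool)) =>
          c.1.Injective ∧ IsTraced f c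
    · exact Finset.filter_congr_decidable ..
    · exact Finset.filter_congr_decidable ..
  have hle : ∀ c : (Fin (m + 3) → V) × (Fin (m + 3) → I) × (Fin (m + 3) → Bool),
      (Finset.univ.filter fun f : V × I → V => c.1.Injective ∧ IsTraced f c).card *
        Fintype.card V ^ (m + 3) ≤ Fintype.card V ^ Fintype.card (V × I) := by
    intro c
    by_cases hc : c.1.Injective
    · simpa [hc] using card_filter_isTraced_mul_le c hc
    · simp [hc]
  rw [hswap, Finset.sum_mul]
  refine (Finset.sum_le_sum fun c _ => hle c).trans (le_of_eq ?_)
  simp only [Finset.sum_const, Finset.card_univ, Fintype.card_prod, Fintype.card_fun,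
    Fintype.card_fin, Fintype.card_bool, smul_eq_mul]
  ring

theorem exists_mem_tracedCycles {V I : Type*} [Fintype V] [Fintype I] {f : V × I → V} {m : ℕ}
    (φ : Copy (cycleGraph (m + 3)) (outGraph f)) : ∃ c ∈ tracedCycles f m, c.1 = φ := by
  have hadj (j : Fin (m + 3)) : ∃ (i : I) (b : Bool),
      f (if b then φ j else φ (j + 1), i) = if b then φ (j + 1) else φ j := by
    have h : (cycleGraph (m + 3)).Adj j (j + 1) := by simp [cycleGraph_adj]
    have h' : (outGraph f).Adj (φ j) (φ (j + 1)) := φ.toHom.map_adj h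
    simp only [outGraph, fromRel_adj] at h'
    rcases h'.2 with ⟨i, hi⟩ | ⟨i, hi⟩
    · exact ⟨i, true, hi⟩
    · exact ⟨i, false, hi⟩
  choose i b h using hadj
  classical
  exact ⟨(φ, i, b), Finset.mem_filter.2 ⟨Finset.mem_univ _, φ.injective, h⟩, rfl⟩

theorem card_filter_isIndepSet_le {V I : Type*} [Fintype V] [Fintype I] [DecidableEq V]
    [DecidableEq I] (S : Finset V) {t : ℕ} (hS : S.card = t + 1)
    [DecidablePred fun f : V × I → V => (outGraph f).IsIndepSet S] :
    (Finset.univ.filter fun f : V × I → V => (outGraph f).IsIndepSet S).card ≤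
      (Fintype.card V - t) ^ ((t + 1) * Fintype.card I) *
        Fintype.card V ^ ((Fintype.card V - (t + 1)) * Fintype.card I) := by
  classical
  calc _ ≤ (Fintype.piFinset fun p : V × I =>
          if p.1 ∈ S then (S.erase p.1)ᶜ else Finset.univ).card := by
        refine Finset.card_le_card fun f hf => Fintype.mem_piFinset.2 fun p => ?_
        split_ifs with hp
        · simp only [Finset.mem_compl, Finset.mem_erase, not_and]
          intro hne hmem
          refine (Finset.mem_filter.1 hf).2 hp hmem hne.symm ?_
          exact (fromRel_adj _ _ _).2 ⟨hne.symm, Or.inl ⟨p.2, rfl⟩⟩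
        · simp
    _ = ∏ p : V × I, if p.1 ∈ S then Fintype.card V - t else Fintype.card V := by
        rw [Fintype.card_piFinset]
        refine Finset.prod_congr rfl fun p _ => ?_
        split_ifs with hp
        · rw [Finset.card_compl, Finset.card_erase_of_mem hp, hS, Nat.add_sub_cancel]
        · rfl
    _ = _ := by
        have hcompl : (Finset.univ.filter (· ∉ S)).card = Fintype.card V - (t + 1) := by
          rw [← hS, ← Finset.card_compl]
          exact congrArg _ (by ext; simp)
        rw [Fintype.prod_prod_type_right]
        change (∏ _y : I, ∏ x : V, if x ∈ S then Fintype.card V - t else Fintype.card V) = _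
        rw [Finset.prod_const, Finset.card_univ, Finset.prod_ite, Finset.prod_const,
          Finset.prod_const, hcompl, Finset.filter_univ_mem, hS, mul_pow, ← pow_mul, ← pow_mul]

theorem exists_four_pow_mul_pow_le {K : ℕ} (hK : 0 < K) : ∃ d, 4 ^ K * (K - 1) ^ d ≤ K ^ d := by
  have hK' : (0 : ℝ) < K := by exact_mod_cast hK
  obtain ⟨d, hd⟩ := exists_pow_lt_of_lt_one (x := (1 / 4 ^ K : ℝ)) (y := ((K - 1 : ℕ) : ℝ) / K)
    (by positivity) (by rw [div_lt_one hK']; exact_mod_cast Nat.sub_lt hK one_pos)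
  refine ⟨d, ?_⟩
  rw [div_pow, div_lt_div_iff₀ (by positivity) (by positivity)] at hd
  have h : ((4 ^ K * (K - 1) ^ d : ℕ) : ℝ) ≤ (K ^ d : ℕ) := by
    rw [Nat.cast_mul, Nat.cast_pow, Nat.cast_pow, Nat.cast_pow]
    push_cast
    linarith
  exact_mod_cast h

open scoped Classical in
theorem two_mul_card_exists_isIndepSet_le {K d t : ℕ} (hK : 0 < K) (ht : 0 < t)
    (hd : 4 ^ K * (K - 1) ^ d ≤ K ^ d) :
    2 * (Finset.univ.filter fun f : Fin (K * t) × Fin d → Fin (K * t) =>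
      ∃ S : Finset (Fin (K * t)), S.card = t + 1 ∧ (outGraph f).IsIndepSet S).card ≤
      (K * t) ^ (K * t * d) := by
  set n := K * t with hn
  have hbase : 4 ^ n * (n - t) ^ ((t + 1) * d) ≤ n ^ ((t + 1) * d) := by
    have hnt : n - t = (K - 1) * t := by rw [hn, Nat.sub_mul, one_mul]
    calc 4 ^ n * (n - t) ^ ((t + 1) * d)
        ≤ 4 ^ (K * (t + 1)) * ((K - 1) * t) ^ ((t + 1) * d) := by
          rw [hnt]
          gcongr <;> lia
      _ = (4 ^ K * (K - 1) ^ d) ^ (t + 1) * t ^ ((t + 1) * d) := by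
          rw [mul_pow, mul_pow, ← pow_mul, ← pow_mul, mul_comm d]; ring
      _ ≤ (K ^ d) ^ (t + 1) * t ^ ((t + 1) * d) := by gcongr
      _ = n ^ ((t + 1) * d) := by rw [hn, mul_pow, ← pow_mul, mul_comm d]
  have hset (S : Finset (Fin n)) (hS : S.card = t + 1) : 4 ^ n *
      (Finset.univ.filter fun f : Fin n × Fin d → Fin n => (outGraph f).IsIndepSet S).card ≤
        n ^ (n * d) := by
    have hle : t + 1 ≤ n := by simpa [hS] using Finset.card_le_univ S
    have hcard := card_filter_isIndepSet_le (I := Fin d) S hS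
    simp only [Fintype.card_fin] at hcard
    calc _ ≤ 4 ^ n * ((n - t) ^ ((t + 1) * d) * n ^ ((n - (t + 1)) * d)) :=
          Nat.mul_le_mul_left _ hcard
      _ ≤ n ^ ((t + 1) * d) * n ^ ((n - (t + 1)) * d) := by
          rw [← mul_assoc]
          exact Nat.mul_le_mul_right _ hbase
      _ = n ^ (n * d) := by rw [← pow_add, ← add_mul, Nat.add_sub_cancel' hle]
  have hunion : (Finset.univ.filter fun f : Fin n × Fin d → Fin n =>
      ∃ S : Finset (Fin n), S.card = t + 1 ∧ (outGraph f).IsIndepSet S) ⊆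
      (Finset.powersetCard (t + 1) (Finset.univ : Finset (Fin n))).biUnion fun S =>
        Finset.univ.filter fun f : Fin n × Fin d → Fin n => (outGraph f).IsIndepSet S := by
    intro f hf
    simpa using hf
  have hpow : (Finset.powersetCard (t + 1) (Finset.univ : Finset (Fin n))).card ≤ 2 ^ n := by
    simpa using Nat.choose_le_two_pow n (t + 1)
  have htotal : 4 ^ n * (Finset.univ.filter fun f : Fin n × Fin d → Fin n =>
      ∃ S : Finset (Fin n), S.card = t + 1 ∧ (outGraph f).IsIndepSet S).card ≤
        2 ^ n * n ^ (n * d) := by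
    calc _ ≤ 4 ^ n * ∑ S ∈ Finset.powersetCard (t + 1) (Finset.univ : Finset (Fin n)),
            (Finset.univ.filter fun f : Fin n × Fin d → Fin n => (outGraph f).IsIndepSet S).card :=
          Nat.mul_le_mul_left _ ((Finset.card_le_card hunion).trans Finset.card_biUnion_le)
      _ ≤ ∑ S ∈ Finset.powersetCard (t + 1) (Finset.univ : Finset (Fin n)), n ^ (n * d) := by
          rw [Finset.mul_sum]
          exact Finset.sum_le_sum fun S hS => hset S (Finset.mem_powersetCard.1 hS).2
      _ ≤ 2 ^ n * n ^ (n * d) := by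
          rw [Finset.sum_const, smul_eq_mul]
          exact Nat.mul_le_mul_right _ hpow
  have hn0 : n ≠ 0 := (Nat.mul_pos hK ht).ne'
  rw [show (4 : ℕ) = 2 * 2 from rfl, mul_pow, mul_assoc] at htotal
  exact (Nat.mul_le_mul_right _ (Nat.le_self_pow hn0 2)).trans
    (Nat.le_of_mul_le_mul_left htotal (by positivity))

theorem exists_few_tracedCycles (g : ℕ) {k : ℕ} (hk : 0 < k) :
    ∃ (t d : ℕ) (f : Fin (2 * k * t) × Fin d → Fin (2 * k * t)),
      (∀ S : Finset (Fin (2 * k * t)), S.card = t + 1 → ¬(outGraph f).IsIndepSet S) ∧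
      ∑ m ∈ Finset.range g, (tracedCycles f m).card < k * t := by
  classical
  obtain ⟨d, hd⟩ := exists_four_pow_mul_pow_le (K := 2 * k) (by lia)
  set B := ∑ m ∈ Finset.range g, (2 * d) ^ (m + 3) with hB
  refine ⟨2 * B + 1, d, ?_⟩
  set t := 2 * B + 1 with ht
  set n := 2 * k * t with hn
  have hn0 : 0 < n := by positivity
  have : Nonempty (Fin n) := ⟨⟨0, hn0⟩⟩
  have hbad := two_mul_card_exists_isIndepSet_le (K := 2 * k) (t := t) (by lia) (by lia) hd
  rw [← hn] at hbad
  set bad := Finset.univ.filter fun f : Fin n × Fin d → Fin n =>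
    ∃ S : Finset (Fin n), S.card = t + 1 ∧ (outGraph f).IsIndepSet S
  by_contra! hcon
  have hupper : ∑ f : Fin n × Fin d → Fin n, ∑ m ∈ Finset.range g, (tracedCycles f m).card ≤
      B * n ^ (n * d) := by
    rw [Finset.sum_comm, hB, Finset.sum_mul]
    refine Finset.sum_le_sum fun m _ => ?_
    simpa using sum_card_tracedCycles_le (V := Fin n) (I := Fin d) m
  have hlower : badᶜ.card * (k * t) ≤
      ∑ f : Fin n × Fin d → Fin n, ∑ m ∈ Finset.range g, (tracedCycles f m).card := by
    rw [← smul_eq_mul, ← Finset.sum_const]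
    refine (Finset.sum_le_sum fun f hf => hcon f fun S hS hi => ?_).trans
      (Finset.sum_le_sum_of_subset (Finset.subset_univ _))
    exact Finset.mem_compl.1 hf (Finset.mem_filter.2 ⟨Finset.mem_univ _, S, hS, hi⟩)
  have hcompl : bad.card + badᶜ.card = n ^ (n * d) := by simp
  have hN : 0 < n ^ (n * d) := by positivity
  have hkt : t ≤ k * t := Nat.le_mul_of_pos_left t hk
  have hbt : badᶜ.card * t ≤ B * n ^ (n * d) :=
    (Nat.mul_le_mul_left _ hkt).trans (hlower.trans hupper)
  nlinarith

theorem exists_cycleGraph_free_not_colorable (g : ℕ) {k : ℕ} (hk : 0 < k) :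
    ∃ (V : Type) (_ : Fintype V) (G : SimpleGraph V),
      (∀ m < g, (cycleGraph (m + 3)).Free G) ∧ ¬G.Colorable k := by
  classical
  obtain ⟨t, d, f, hind, hcyc⟩ := exists_few_tracedCycles g hk
  set R := (Finset.range g).biUnion fun m => (tracedCycles f m).image fun c => c.1 0 with hR
  have hRcard : R.card < k * t :=
    (Finset.card_biUnion_le.trans (Finset.sum_le_sum fun _ _ => Finset.card_image_le)).trans_lt hcyc
  refine ⟨{x // x ∈ Rᶜ}, inferInstance, (outGraph f).induce {x | x ∈ Rᶜ}, ?_, ?_⟩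
  · rintro m hm ⟨φ⟩
    obtain ⟨c, hc, hcφ⟩ := exists_mem_tracedCycles ((Copy.induce (outGraph f) _).comp φ)
    refine Finset.mem_compl.1 (φ 0).2 (Finset.mem_biUnion.2
      ⟨m, Finset.mem_range.2 hm, Finset.mem_image.2 ⟨c, hc, ?_⟩⟩)
    rw [hcφ]
    rfl
  · rintro ⟨C⟩
    have hcard : Fintype.card (Fin k) * t < Fintype.card {x // x ∈ Rᶜ} := by
      simp only [Fintype.card_coe, Finset.card_compl, Fintype.card_fin, mul_assoc]
      lia
    obtain ⟨y, hy⟩ := Fintype.exists_lt_card_fiber_of_mul_lt_card C hcard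
    obtain ⟨S, hS, hScard⟩ := Finset.exists_subset_card_eq (Nat.succ_le_of_lt hy)
    refine hind (S.map (Function.Embedding.subtype _)) (by rw [Finset.card_map, hScard]) ?_
    intro a ha b hb _ hab
    obtain ⟨a, haS, rfl⟩ := Finset.mem_map.1 (Finset.mem_coe.1 ha)
    obtain ⟨b, hbS, rfl⟩ := Finset.mem_map.1 (Finset.mem_coe.1 hb)
    have ha' := (Finset.mem_filter.1 (hS haS)).2
    have hb' := (Finset.mem_filter.1 (hS hbS)).2
    exact C.valid (v := a) (w := b) hab (ha'.trans hb'.symm)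

/-- A graph which is not `k`-colorable has an induced subgraph of chromatic number `k + 1`. -/
theorem exists_induce_chromaticNumber_eq {V : Type*} [Finite V] {G : SimpleGraph V} {k : ℕ}
    (h : ¬G.Colorable k) : ∃ s : Set V, (G.induce s).chromaticNumber = k + 1 := by
  classical
  obtain ⟨s, hs, hmin⟩ := (Set.toFinite {s : Set V | ¬(G.induce s).Colorable k}).exists_minimal
    ⟨Set.univ, fun hc => h (hc.of_hom (induceUnivIso G).symm.toHom)⟩
  refine ⟨s, chromaticNumber_eq_iff_colorable_not_colorable.2 ⟨?_, hs⟩⟩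
  obtain ⟨v, hv⟩ : s.Nonempty := by
    by_contra hne
    rw [Set.not_nonempty_iff_eq_empty] at hne
    subst hne
    exact hs (.of_isEmpty k)
  have hsub : (G.induce (s \ {v})).Colorable k := by
    by_contra hc
    exact (hmin hc Set.sdiff_subset hv).2 rfl
  obtain ⟨C⟩ := hsub
  refine ⟨Coloring.mk (fun x => if hx : x.1 = v then Fin.last k else (C ⟨x.1, x.2, hx⟩).castSucc)
    fun {x y} hxy => ?_⟩
  have hne : x.1 ≠ y.1 := fun he => hxy.ne (Subtype.ext he)
  by_cases hx : x.1 = v <;> by_cases hy : y.1 = v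
  · exact (hne (hx.trans hy.symm)).elim
  · simpa [hx, hy] using (Fin.castSucc_lt_last _).ne'
  · simp [hx, hy]
  · simpa [hx, hy] using C.valid (v := ⟨x.1, x.2, hx⟩) (w := ⟨y.1, y.2, hy⟩) hxy

theorem dvd_of_cycleGraph_isContained {l g : ℕ} (hl : 3 ≤ l) (hg : 3 ≤ g)
    (h : cycleGraph l ⊑ cycleGraph g) : g ∣ l := by
  obtain ⟨l, rfl⟩ := Nat.exists_eq_add_of_le' hl
  obtain ⟨g, rfl⟩ := Nat.exists_eq_add_of_le' hg
  obtain ⟨φ⟩ := h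
  set u : ℕ → ZMod (g + 3) := fun i => φ (Fin.ofNat (l + 3) i) with hu
  have hsucc (i : ℕ) : Fin.ofNat (l + 3) (i + 1) = Fin.ofNat (l + 3) i + 1 := by
    simp [Fin.ext_iff, Fin.val_add]
  have hadj (i : ℕ) : u (i + 1) = u i + 1 ∨ u (i + 1) = u i - 1 := by
    have h : (cycleGraph (l + 3)).Adj (Fin.ofNat _ i) (Fin.ofNat _ (i + 1)) := by
      rw [hsucc, cycleGraph_adj]
      simp
    rcases cycleGraph_adj.1 (φ.toHom.map_adj h) with h | h
    · exact Or.inr (by rw [eq_sub_iff_add_eq', eq_comm, ← sub_eq_iff_eq_add]; exact h)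
    · exact Or.inl (by rw [← sub_eq_iff_eq_add']; exact h)
  have hne (i : ℕ) : u (i + 2) ≠ u i := by
    intro he
    have := φ.injective he
    rw [hsucc, hsucc, add_assoc, add_eq_left] at this
    simp only [Fin.ext_iff, Fin.val_add, Fin.val_one, Fin.val_zero, Nat.reduceAdd] at this
    rw [Nat.mod_eq_of_lt (by lia)] at this
    lia
  have hloop : u (l + 3) = u 0 := by
    have : Fin.ofNat (l + 3) (l + 3) = Fin.ofNat (l + 3) 0 := by simp
    exact congrArg φ this
  clear_value u
  have hstep (i : ℕ) : u (i + 1) - u i = u 1 - u 0 := by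
    induction i with
    | zero => rfl
    | succ i ih =>
      rw [← ih]
      rcases hadj i with h | h <;> rcases hadj (i + 1) with h' | h'
      · rw [h', h]; ring
      · exact (hne i (by rw [h', h]; ring)).elim
      · exact (hne i (by rw [h', h]; ring)).elim
      · rw [h', h]; ring
  have hlin (i : ℕ) : u i = u 0 + i * (u 1 - u 0) := by
    induction i with
    | zero => simp
    | succ i ih =>
      push_cast
      linear_combination hstep i + ih
  have hzero : ((l + 3 : ℕ) : ZMod (g + 3)) = 0 := by
    have h1 := hlin (l + 3)
    rw [hloop, left_eq_add] at h1
    rcases hadj 0 with h | h <;> rw [zero_add] at h <;> rw [h] at h1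
    · linear_combination h1
    · linear_combination -h1
  exact (ZMod.natCast_eq_zero_iff _ _).1 hzero

theorem isContained_or_isContained_of_cycleGraph_isContained_sum {V W : Type*}
    {G : SimpleGraph V} {H : SimpleGraph W} {l : ℕ} (h : cycleGraph (l + 1) ⊑ G ⊕g H) :
    cycleGraph (l + 1) ⊑ G ∨ cycleGraph (l + 1) ⊑ H := by
  obtain ⟨φ⟩ := h
  have hwalk (a b : Fin (l + 1)) (w : (cycleGraph (l + 1)).Walk a b) :
      (φ a).isLeft = (φ b).isLeft := by
    induction w with
    | nil => rfl
    | @cons a b c hab _ ih =>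
      rw [← ih]
      have h' : (G ⊕g H).Adj (φ a) (φ b) := φ.toHom.map_adj hab
      revert h'
      rcases φ a with x | x <;> rcases φ b with y | y <;> simp
  have hside (j : Fin (l + 1)) : (φ j).isLeft = (φ 0).isLeft :=
    (cycleGraph_connected.preconnected j 0).elim (hwalk j 0)
  cases h0 : (φ 0).isLeft
  · right
    choose v hv using fun j => Sum.isRight_iff.1 (Sum.isLeft_eq_false.1 ((hside j).trans h0))
    refine ⟨⟨⟨v, fun {a b} hab => ?_⟩, fun a b hab => φ.injective ?_⟩⟩
    · have h' : (G ⊕g H).Adj (φ a) (φ b) := φ.toHom.map_adj hab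
      simpa [hv] using h'
    · exact (hv a).trans ((congrArg Sum.inr hab).trans (hv b).symm)
  · left
    choose v hv using fun j => Sum.isLeft_iff.1 ((hside j).trans h0)
    refine ⟨⟨⟨v, fun {a b} hab => ?_⟩, fun a b hab => φ.injective ?_⟩⟩
    · have h' : (G ⊕g H).Adj (φ a) (φ b) := φ.toHom.map_adj hab
      simpa [hv] using h'
    · exact (hv a).trans ((congrArg Sum.inl hab).trans (hv b).symm)

theorem girth_eq_of_isContained_of_free {V : Type*} {G : SimpleGraph V} {g : ℕ} (hg : 3 ≤ g)
    (hcont : cycleGraph g ⊑ G) (hfree : ∀ l, 3 ≤ l → l < g → (cycleGraph l).Free G) :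
    G.girth = g := by
  obtain ⟨v, p, hp, hlen⟩ := (cycleGraph_isContained_iff hg).1 hcont
  obtain ⟨w, q, hq, hq'⟩ := exists_girth_eq_length.2 fun hac => hac p hp
  refine le_antisymm (hlen ▸ girth_le_length hp) ?_
  rw [hq']
  by_contra! hlt
  exact hfree _ hq.three_le_length hlt
    ((cycleGraph_isContained_iff hq.three_le_length).2 ⟨w, q, hq, rfl⟩)

/- Statement 17 -/
theorem stmt17 (g k : ℕ) (hg : 3 ≤ g) (hk : 3 ≤ k) :
    ∃ (V : Type) (_ : Fintype V) (G : SimpleGraph V),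
      G.girth = g ∧ G.chromaticNumber = k := by
  classical
  obtain ⟨k, rfl⟩ := Nat.exists_eq_add_of_le' (show 1 ≤ k by lia)
  obtain ⟨V, _, G, hfree, hcol⟩ := exists_cycleGraph_free_not_colorable g (k := k) (by lia)
  obtain ⟨s, hs⟩ := exists_induce_chromaticNumber_eq hcol
  refine ⟨s ⊕ Fin g, inferInstance, G.induce s ⊕g cycleGraph g, ?_, ?_⟩
  · refine girth_eq_of_isContained_of_free hg ⟨Embedding.sumInr.toCopy⟩ fun l hl hlg hc => ?_
    obtain ⟨l, rfl⟩ := Nat.exists_eq_add_of_le' hl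
    rcases isContained_or_isContained_of_cycleGraph_isContained_sum hc with h | h
    · exact hfree l (by lia) (h.trans ⟨Copy.induce G s⟩)
    · exact hlg.not_ge (Nat.le_of_dvd (by lia) (dvd_of_cycleGraph_isContained hl hg h))
  · have hcyc : (cycleGraph g).chromaticNumber ≤ ((k + 1 : ℕ) : ℕ∞) := by
      refine Colorable.chromaticNumber_le (Colorable.mono hk ?_)
      exact ⟨cycleGraph.tricoloring g (by lia)⟩
    rw [chromaticNumber_sum, hs]
    exact max_eq_left (by exact_mod_cast hcyc)
end

section
/- The 23-vertex graph M_5 is triangle-free (contains no induced subgraph isomorphic to C_3) and has chromatic number exactly 5. -/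
open SimpleGraph

/-- The colouring step of Mycielski's theorem: if `G` contains the Mycielskian of `H`, with
originals `u`, shadows `s` and apex `z`, then an `(n + 1)`-colouring of `G` yields an
`n`-colouring of `H`. -/
theorem colorable_of_mycielskian {V W : Type*} {G : SimpleGraph V} {H : SimpleGraph W} {n : ℕ}
    (u s : W → V) (z : V) (huu : ∀ a b, H.Adj a b → G.Adj (u a) (u b))
    (hsu : ∀ a b, H.Adj a b → G.Adj (s a) (u b)) (hsz : ∀ a, G.Adj (s a) z)
    (hG : G.Colorable (n + 1)) : H.Colorable n := by
  obtain ⟨c⟩ := hG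
  let d : W → {x : Fin (n + 1) // x ≠ c z} := fun a =>
    if h : c (u a) = c z then ⟨c (s a), c.valid (hsz a)⟩ else ⟨c (u a), h⟩
  have hd : ∀ {a b}, H.Adj a b → d a ≠ d b := by
    intro a b hab
    have h₁ := c.valid (huu a b hab)
    have h₂ := c.valid (hsu a b hab)
    have h₃ := c.valid (hsu b a hab.symm)
    grind
  simpa using (Coloring.mk d hd).colorable

instance : DecidableRel M5.Adj :=
  inferInstanceAs (DecidableRel (fromRel _).Adj)

theorem M5_adj_induction {P : Fin 23 → Fin 23 → Prop}
    (h : ∀ e ∈ M5Edges, P (vtx e.1) (vtx e.2) ∧ P (vtx e.2) (vtx e.1)) {x y : Fin 23}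
    (hxy : M5.Adj x y) : P x y := by
  obtain ⟨-, ⟨e, he, rfl, rfl⟩ | ⟨e, he, rfl, rfl⟩⟩ := hxy
  exacts [(h e he).1, (h e he).2]

/-- The neighbourhood of a vertex of `M5`, encoded as the set of binary digits of a number. -/
def M5Mask (x : Fin 23) : ℕ :=
  M5Edges.foldr (fun e m =>
    if vtx e.1 = x then m ||| 2 ^ (vtx e.2).val
    else if vtx e.2 = x then m ||| 2 ^ (vtx e.1).val else m) 0

theorem testBit_M5Mask {x y : Fin 23} (h : M5.Adj x y) : (M5Mask x).testBit y = true :=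
  M5_adj_induction (P := fun x y => (M5Mask x).testBit y = true) (by decide +kernel) h

theorem M5_triangle_free {x y w : Fin 23} (hxy : M5.Adj x y) (hyw : M5.Adj y w) :
    ¬ M5.Adj x w := by
  intro hxw
  have disj : M5Mask x &&& M5Mask y = 0 :=
    M5_adj_induction (P := fun x y => M5Mask x &&& M5Mask y = 0) (by decide +kernel) hxy
  have := congrArg (fun m => m.testBit w) disj
  simp [testBit_M5Mask hxw, testBit_M5Mask hyw] at this

theorem M5_colorable_five : M5.Colorable 5 := by
  let c : Fin 23 → Fin 5 :=
    ![0, 1, 0, 1, 2, 0, 1, 0, 1, 2, 3, 0, 1, 0, 1, 2, 0, 1, 0, 1, 2, 3, 4]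
  exact ⟨Coloring.mk c fun h => M5_adj_induction (P := fun x y => c x ≠ c y) (by decide +kernel) h⟩

theorem M5_not_colorable_four : ¬ M5.Colorable 4 := by
  intro h
  let M4 : SimpleGraph (Fin 11) := M5.comap (Fin.castLE (by omega))
  let M3 : SimpleGraph (Fin 5) := M4.comap (Fin.castLE (by omega))
  have h4 : M4.Colorable 3 :=
    colorable_of_mycielskian (G := M5) (Fin.castLE (by omega)) (fun a => ⟨a + 11, by omega⟩) 22
      (fun _ _ hab => hab) (by decide +kernel) (by decide +kernel) h
  have h3 : M3.Colorable 2 :=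
    colorable_of_mycielskian (G := M4) (Fin.castLE (by omega)) (fun a => ⟨a + 5, by omega⟩) 10
      (fun _ _ hab => hab) (by decide +kernel) (by decide +kernel) h4
  obtain ⟨c⟩ := h3
  have h01 : c 0 ≠ c 1 := c.valid (by decide +kernel)
  have h12 : c 1 ≠ c 2 := c.valid (by decide +kernel)
  have h24 : c 2 ≠ c 4 := c.valid (by decide +kernel)
  have h43 : c 4 ≠ c 3 := c.valid (by decide +kernel)
  have h30 : c 3 ≠ c 0 := c.valid (by decide +kernel)
  omega

/- Statement 19 -/
theorem stmt19 : IsEmpty (cycleGraph 3 ↪g M5) ∧ M5.chromaticNumber = 5 := by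
  refine ⟨⟨fun f => ?_⟩, ?_⟩
  · have adj : ∀ i j : Fin 3, i ≠ j → M5.Adj (f i) (f j) := fun i j hij =>
      f.map_adj_iff.2 (by revert i j; decide)
    exact M5_triangle_free (adj 0 1 (by decide)) (adj 1 2 (by decide)) (adj 0 2 (by decide))
  · refine le_antisymm (by exact_mod_cast M5_colorable_five.chromaticNumber_le) ?_
    by_contra! hlt
    exact M5_not_colorable_four
      (chromaticNumber_le_iff_colorable.1 (Order.le_of_lt_add_one (by exact_mod_cast hlt)))
end
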